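/- arXiv:2010.04439 — 9 statements merged into one kernel-verified Lean document; each statement's English description precedes it below -/
import Mathlib

section
/- Let p be an odd prime, let x₁, x₂, y₁, y₂ be integers, and set r₁ = ⟨x₁⟩_p, r₂ = ⟨x₂⟩_p. If r₁ + r₂ < p - 1, then p divides Σ_{k=0}^{p-1} D_k(x₁,y₁)·D_k(x₂,y₂). -/
/-- `D n x y = ∑_{k=0}^{n} C(n,k)·C(x,k)·y^k` where `C(x,k)` is the
integer-valued binomial coefficient (Mathlib's `Ring.choose`). -/
def D (n : ℕ) (x y : ℤ) : ℤ :=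
  ∑ k ∈ Finset.range (n + 1), (n.choose k : ℤ) * Ring.choose x k * y ^ k

open Polynomial in
/-- Sums over `ZMod p` of powers with exponent below `p - 1` vanish, hence so do sums of values of
polynomials of degree below `p - 1`. -/
theorem sum_range_eval_eq_zero {p : ℕ} [Fact p.Prime] (f : (ZMod p)[X])
    (hf : f.natDegree < p - 1) : ∑ n ∈ Finset.range p, f.eval (n : ZMod p) = 0 := by
  have hsum : ∑ n ∈ Finset.range p, f.eval (n : ZMod p) = ∑ a : ZMod p, f.eval a := by
    refine Finset.sum_bij (fun n _ => (n : ZMod p)) (fun _ _ => Finset.mem_univ _) ?_ ?_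
      (fun _ _ => rfl)
    · intro a ha b hb hab
      rw [Finset.mem_range] at ha hb
      simpa [Nat.ModEq, Nat.mod_eq_of_lt ha, Nat.mod_eq_of_lt hb] using
        (ZMod.natCast_eq_natCast_iff a b p).1 hab
    · intro b _
      exact ⟨b.val, Finset.mem_range.2 (ZMod.val_lt b), by simp⟩
  rw [hsum]
  simp_rw [eval_eq_sum_range]
  rw [Finset.sum_comm]
  refine Finset.sum_eq_zero fun i hi => ?_
  rw [← Finset.mul_sum, FiniteField.sum_pow_lt_card_sub_one (K := ZMod p) i, mul_zero]
  rw [ZMod.card]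
  have := Finset.mem_range.1 hi
  omega

theorem factorial_ne_zero_zmod {p k : ℕ} [Fact p.Prime] (hk : k < p) :
    (k.factorial : ZMod p) ≠ 0 := by
  rw [Ne, ZMod.natCast_eq_zero_iff, (Fact.out : p.Prime).dvd_factorial]
  omega

theorem ringChoose_zmod_eq_zero {p k r : ℕ} [Fact p.Prime] {x : ℤ} (hr : (r : ℤ) = x % p)
    (hrk : r < k) (hk : k < p) : ((Ring.choose x k : ℤ) : ZMod p) = 0 := by
  have hx : (p : ℤ) ∣ x - r := by rw [hr]; exact Int.dvd_self_sub_emod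
  have hdvd := hx.trans (Polynomial.sub_dvd_eval_sub x r (descPochhammer ℤ k))
  rw [descPochhammer_eval_eq_descFactorial, Nat.descFactorial_of_lt hrk, Nat.cast_zero, sub_zero,
    Polynomial.eval_eq_smeval, Ring.descPochhammer_eq_factorial_smul_choose, nsmul_eq_mul,
    ← ZMod.intCast_zmod_eq_zero_iff_dvd] at hdvd
  push_cast at hdvd
  exact (mul_eq_zero.1 hdvd).resolve_left (factorial_ne_zero_zmod hk)

open Polynomial in
/-- Modulo `p`, the values `D n x y` with `n < p` are those of a polynomial in `n` of degree at
most the residue of `x`. -/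
theorem exists_polynomial_eval_eq_D {p r : ℕ} [Fact p.Prime] {x : ℤ} (y : ℤ)
    (hr : (r : ℤ) = x % p) :
    ∃ f : (ZMod p)[X], f.natDegree ≤ r ∧ ∀ n < p, f.eval (n : ZMod p) = (D n x y : ZMod p) := by
  refine ⟨∑ k ∈ Finset.range p, C (((Ring.choose x k : ℤ) : ZMod p) * (y : ZMod p) ^ k *
    (k.factorial : ZMod p)⁻¹) * descPochhammer (ZMod p) k, ?_, fun n hn => ?_⟩
  · refine natDegree_sum_le_of_forall_le _ _ fun k hk => ?_
    rcases le_or_gt k r with h | h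
    · refine (natDegree_C_mul_le _ _).trans ?_
      rwa [descPochhammer_natDegree]
    · simp [ringChoose_zmod_eq_zero hr h (Finset.mem_range.1 hk)]
  · rw [D, eval_finsetSum]
    push_cast
    symm
    rw [← Finset.sum_subset (Finset.range_mono (Nat.succ_le_of_lt hn))]
    · refine Finset.sum_congr rfl fun k hk => ?_
      have hk' := factorial_ne_zero_zmod (p := p) (k := k)
        (by have := Finset.mem_range.1 hk; omega)
      rw [eval_C_mul, descPochhammer_eval_eq_descFactorial,
        Nat.descFactorial_eq_factorial_mul_choose]
      push_cast
      field_simp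
    · intro k _ hk
      rw [eval_C_mul, descPochhammer_eval_eq_descFactorial, Nat.descFactorial_of_lt]
      · simp
      · simpa using hk

theorem stmt_0 (p : ℕ) (hp : p.Prime) (hodd : Odd p)
    (x₁ x₂ y₁ y₂ : ℤ) (r₁ r₂ : ℕ)
    (hr₁ : (r₁ : ℤ) = x₁ % p) (hr₂ : (r₂ : ℤ) = x₂ % p)
    (h : r₁ + r₂ < p - 1) :
    (p : ℤ) ∣ ∑ k ∈ Finset.range p, D k x₁ y₁ * D k x₂ y₂ := by
  have : Fact p.Prime := ⟨hp⟩
  obtain ⟨f, hf, hfD⟩ := exists_polynomial_eval_eq_D y₁ hr₁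
  obtain ⟨g, hg, hgD⟩ := exists_polynomial_eval_eq_D y₂ hr₂
  have hfg := sum_range_eval_eq_zero (f * g) (by
    have := Polynomial.natDegree_mul_le (p := f) (q := g)
    omega)
  rw [← ZMod.intCast_zmod_eq_zero_iff_dvd, ← hfg, Int.cast_sum]
  refine Finset.sum_congr rfl fun n hn => ?_
  rw [Polynomial.eval_mul, hfD n (Finset.mem_range.1 hn), hgD n (Finset.mem_range.1 hn),
    Int.cast_mul]
end

section
/- Let p be an odd prime, let x₁, x₂, y₁, y₂ be integers, and set r₁ = ⟨x₁⟩_p, r₂ = ⟨x₂⟩_p. If r₁ + r₂ = p - 1, then Σ_{k=0}^{p-1} D_k(x₁,y₁)·D_k(x₂,y₂) ≡ y₁^{r₁}·(-y₂)^{r₂} (mod p). -/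
open Polynomial in
/-- The polynomial over `ZMod p` whose value at a natural number `n < p` is `D n x y` modulo `p`
whenever `x ≡ r` modulo `p` and `r < p`. -/
noncomputable def polyD (p : ℕ) [Fact p.Prime] (r : ℕ) (y : ZMod p) : (ZMod p)[X] :=
  ∑ j ∈ Finset.range (r + 1),
    C ((r.choose j : ZMod p) * y ^ j * (j.factorial : ZMod p)⁻¹) * descPochhammer (ZMod p) j

section

variable {p : ℕ} [Fact p.Prime]

lemma factorial_natCast_zmod_ne_zero {k : ℕ} (hk : k < p) : (k.factorial : ZMod p) ≠ 0 := by
  rw [Ne, ZMod.natCast_eq_zero_iff, (Fact.out : p.Prime).dvd_factorial]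
  omega

lemma factorial_mul_cast_ring_choose (x : ℤ) (k : ℕ) :
    (k.factorial : ZMod p) * ((Ring.choose x k : ℤ) : ZMod p) =
      (descPochhammer (ZMod p) k).eval (x : ZMod p) := by
  have h := Ring.descPochhammer_eq_factorial_smul_choose x k
  rw [← Polynomial.eval_eq_smeval, nsmul_eq_mul] at h
  rw [← descPochhammer_eval_cast, h]
  push_cast
  rfl

lemma cast_ring_choose_eq_cast_choose {x : ℤ} {r k : ℕ} (hx : (x : ZMod p) = r) (hk : k < p) :
    ((Ring.choose x k : ℤ) : ZMod p) = (r.choose k : ZMod p) := by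
  apply mul_left_cancel₀ (factorial_natCast_zmod_ne_zero hk)
  have h := factorial_mul_cast_ring_choose (p := p) (r : ℤ) k
  rw [Ring.choose_natCast] at h
  rw [factorial_mul_cast_ring_choose, hx]
  simpa using h.symm

lemma cast_choose_eq_eval_descPochhammer (n : ℕ) {k : ℕ} (hk : k < p) :
    (n.choose k : ZMod p) =
      (k.factorial : ZMod p)⁻¹ * (descPochhammer (ZMod p) k).eval (n : ZMod p) := by
  rw [descPochhammer_eval_eq_descFactorial, Nat.descFactorial_eq_factorial_mul_choose,
    Nat.cast_mul, inv_mul_cancel_left₀ (factorial_natCast_zmod_ne_zero hk)]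

lemma natDegree_polyD_le (r : ℕ) (y : ZMod p) : (polyD p r y).natDegree ≤ r := by
  refine Polynomial.natDegree_sum_le_of_forall_le _ _ fun j hj => ?_
  refine (Polynomial.natDegree_C_mul_le _ _).trans ?_
  rw [descPochhammer_natDegree]
  exact Nat.lt_succ_iff.mp (Finset.mem_range.mp hj)

lemma coeff_polyD_self (r : ℕ) (y : ZMod p) :
    (polyD p r y).coeff r = y ^ r * (r.factorial : ZMod p)⁻¹ := by
  have hlead : (descPochhammer (ZMod p) r).coeff r = 1 := by
    have h := (monic_descPochhammer (ZMod p) r).coeff_natDegree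
    rwa [descPochhammer_natDegree] at h
  rw [polyD, Polynomial.finsetSum_coeff, Finset.sum_range_succ, Finset.sum_eq_zero]
  · rw [Polynomial.coeff_C_mul, hlead]
    simp
  · intro j hj
    rw [Polynomial.coeff_C_mul, Polynomial.coeff_eq_zero_of_natDegree_lt, mul_zero]
    rw [descPochhammer_natDegree]
    exact Finset.mem_range.mp hj

lemma cast_D_eq_eval_polyD {x : ℤ} {r n : ℕ} (y : ℤ) (hx : (x : ZMod p) = r) (hr : r < p)
    (hn : n < p) : ((D n x y : ℤ) : ZMod p) = (polyD p r y).eval (n : ZMod p) := by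
  have hD : ((D n x y : ℤ) : ZMod p) =
      ∑ k ∈ Finset.range p, (n.choose k : ZMod p) * (r.choose k : ZMod p) * (y : ZMod p) ^ k := by
    rw [← Finset.sum_subset (Finset.range_subset_range.mpr (Nat.succ_le_of_lt hn))]
    · rw [D, Int.cast_sum]
      refine Finset.sum_congr rfl fun k hk => ?_
      rw [Finset.mem_range] at hk
      push_cast
      rw [cast_ring_choose_eq_cast_choose hx (by omega)]
    · intro k _ hk
      rw [Finset.mem_range] at hk
      rw [Nat.choose_eq_zero_of_lt (by omega)]
      simp
  rw [hD, polyD, Polynomial.eval_finsetSum,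
    ← Finset.sum_subset (Finset.range_subset_range.mpr (Nat.succ_le_of_lt hr))]
  · refine Finset.sum_congr rfl fun k hk => ?_
    rw [Finset.mem_range] at hk
    rw [cast_choose_eq_eval_descPochhammer n (by omega), Polynomial.eval_mul, Polynomial.eval_C]
    ring
  · intro k _ hk
    rw [Finset.mem_range] at hk
    rw [Nat.choose_eq_zero_of_lt (n := r) (by omega)]
    simp

lemma sum_range_natCast_zmod {M : Type*} [AddCommMonoid M] (f : ZMod p → M) :
    ∑ k ∈ Finset.range p, f k = ∑ a : ZMod p, f a := by
  refine Finset.sum_nbij' (fun k => (k : ZMod p)) ZMod.val ?_ ?_ ?_ ?_ ?_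
  · simp
  · intro a _
    exact Finset.mem_range.mpr a.val_lt
  · intro k hk
    exact ZMod.val_cast_of_lt (Finset.mem_range.mp hk)
  · simp
  · simp

lemma sum_zmod_pow_sub_one : ∑ a : ZMod p, a ^ (p - 1) = -1 := by
  have hp := (Fact.out : p.Prime).one_lt
  have h (a : ZMod p) : a ^ (p - 1) = 1 - if a = 0 then 1 else 0 := by
    split_ifs with ha
    · rw [ha, zero_pow (by omega), sub_self]
    · rw [ZMod.pow_card_sub_one_eq_one ha, sub_zero]
  simp [h, Finset.sum_sub_distrib]

lemma sum_eval_zmod {f : Polynomial (ZMod p)} (hf : f.natDegree ≤ p - 1) :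
    ∑ a : ZMod p, f.eval a = -f.coeff (p - 1) := by
  simp_rw [Polynomial.eval_eq_sum_range' (Nat.lt_succ_of_le hf)]
  rw [Finset.sum_comm]
  simp_rw [← Finset.mul_sum]
  rw [Finset.sum_range_succ, sum_zmod_pow_sub_one, Finset.sum_eq_zero, zero_add, mul_neg_one]
  intro i hi
  rw [FiniteField.sum_pow_lt_card_sub_one, mul_zero]
  rw [ZMod.card]
  exact Finset.mem_range.mp hi

lemma factorial_mul_factorial_zmod (r s : ℕ) (h : r + s = p - 1) :
    (r.factorial : ZMod p) * (s.factorial : ZMod p) = -(-1) ^ r := by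
  induction r generalizing s with
  | zero =>
    obtain rfl : s = p - 1 := by omega
    simp
  | succ r ih =>
    have h' := ih (s + 1) (by omega)
    have hs : ((s : ZMod p) + 1) = -(r + 1) := by
      have hp : r + 1 + s + 1 = p := by have := (Fact.out : p.Prime).pos; omega
      have := congrArg (Nat.cast : ℕ → ZMod p) hp
      push_cast at this
      rw [CharP.cast_eq_zero (ZMod p) p] at this
      linear_combination this
    rw [Nat.factorial_succ] at h' ⊢
    push_cast at h' ⊢
    rw [hs] at h'
    linear_combination -h'

end

theorem stmt_1 (p : ℕ) (hp : p.Prime) (hodd : Odd p)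
    (x₁ x₂ y₁ y₂ : ℤ) (r₁ r₂ : ℕ)
    (hr₁ : (r₁ : ℤ) = x₁ % p) (hr₂ : (r₂ : ℤ) = x₂ % p)
    (h : r₁ + r₂ = p - 1) :
    (∑ k ∈ Finset.range p, D k x₁ y₁ * D k x₂ y₂) ≡
      y₁ ^ r₁ * (-y₂) ^ r₂ [ZMOD p] := by
  have : Fact p.Prime := ⟨hp⟩
  have hpos := hp.pos
  have cast_eq (x : ℤ) (r : ℕ) (hr : (r : ℤ) = x % p) : (x : ZMod p) = r := by
    rw [← Int.cast_natCast (R := ZMod p) r, hr, ZMod.intCast_mod]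
  rw [← ZMod.intCast_eq_intCast_iff]
  push_cast
  have hsum : ∑ k ∈ Finset.range p, ((D k x₁ y₁ : ℤ) : ZMod p) * ((D k x₂ y₂ : ℤ) : ZMod p) =
      ∑ k ∈ Finset.range p, (polyD p r₁ y₁ * polyD p r₂ y₂).eval (k : ZMod p) := by
    refine Finset.sum_congr rfl fun k hk => ?_
    rw [Finset.mem_range] at hk
    rw [Polynomial.eval_mul, cast_D_eq_eval_polyD y₁ (cast_eq _ _ hr₁) (by omega) hk,
      cast_D_eq_eval_polyD y₂ (cast_eq _ _ hr₂) (by omega) hk]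
  have hdeg₁ := natDegree_polyD_le (p := p) r₁ y₁
  have hdeg₂ := natDegree_polyD_le (p := p) r₂ y₂
  rw [hsum, sum_range_natCast_zmod fun a => (polyD p r₁ y₁ * polyD p r₂ y₂).eval a,
    sum_eval_zmod (h ▸ Polynomial.natDegree_mul_le_of_le hdeg₁ hdeg₂), ← h,
    Polynomial.coeff_mul_add_eq_of_natDegree_le hdeg₁ hdeg₂, coeff_polyD_self, coeff_polyD_self]
  have hsign : (-1 : ZMod p) ^ r₁ * (-1) ^ r₂ = 1 := by
    rw [← pow_add, h, (Nat.Odd.sub_odd hodd odd_one).neg_one_pow]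
  have hinv : (r₁.factorial : ZMod p)⁻¹ * (r₂.factorial : ZMod p)⁻¹ = -(-1) ^ r₂ := by
    rw [← mul_inv, factorial_mul_factorial_zmod r₁ r₂ h]
    exact inv_eq_of_mul_eq_one_right (by linear_combination hsign)
  rw [neg_pow]
  linear_combination -((y₁ : ZMod p) ^ r₁ * (y₂ : ZMod p) ^ r₂) * hinv
end

section
/- Let p be an odd prime, let x₁, x₂, y₁, y₂ be integers with p ∤ y₁ and p ∤ y₂, and suppose ⟨x₁⟩_p = ⟨x₂⟩_p = (p-1)/2. Then Σ_{k=0}^{p-1} S_k(x₁,y₁)·S_k(x₂,y₂) ≡ (-y₁y₂/p) (mod p), where (·/p) is the Legendre symbol. -/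
/-- `S n x y = ∑_{k=0}^{n} C(n,k)·C(x,k)·C(-1-x,k)·y^k` where `C(x,k)` is the
integer-valued binomial coefficient (Mathlib's `Ring.choose`). -/
def S (n : ℕ) (x y : ℤ) : ℤ :=
  ∑ k ∈ Finset.range (n + 1),
    (n.choose k : ℤ) * Ring.choose x k * Ring.choose (-1 - x) k * y ^ k

open Polynomial

theorem ZMod.sum_range_natCast {p : ℕ} [NeZero p] {M : Type*} [AddCommMonoid M]
    (f : ZMod p → M) : ∑ n ∈ Finset.range p, f n = ∑ a : ZMod p, f a :=
  Finset.sum_bij' (fun n _ ↦ (n : ZMod p)) (fun a _ ↦ a.val) (by simp)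
    (by simp [ZMod.val_lt]) (fun n hn ↦ ZMod.val_natCast_of_lt (Finset.mem_range.mp hn))
    (by simp) (by simp)

theorem FiniteField.sum_eval_of_natDegree_le {K : Type*} [Field K] [Fintype K] {P : K[X]}
    (hP : P.natDegree ≤ Fintype.card K - 1) :
    ∑ a : K, P.eval a = -P.coeff (Fintype.card K - 1) := by
  classical
  have hq : Fintype.card K - 1 ≠ 0 := by have := Fintype.one_lt_card (α := K); omega
  have htop : ∑ a : K, a ^ (Fintype.card K - 1) = -1 := by
    rw [Fintype.sum_eq_add_sum_compl 0, zero_pow hq, zero_add,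
      Finset.sum_congr rfl fun a ha ↦ FiniteField.pow_card_sub_one_eq_one a (by simpa using ha)]
    simp [Finset.card_compl, Nat.cast_sub (Fintype.card_pos (α := K)), Finset.sum_const]
  simp_rw [eval_eq_sum_range' (Nat.lt_succ_of_le hP)]
  rw [Finset.sum_comm]
  simp_rw [← Finset.mul_sum]
  rw [Finset.sum_range_succ, htop, Finset.sum_eq_zero, zero_add, mul_neg_one]
  intro i hi
  rw [FiniteField.sum_pow_lt_card_sub_one K i (Finset.mem_range.mp hi), mul_zero]

theorem ZMod.natCast_factorial_ne_zero {p : ℕ} [Fact p.Prime] {k : ℕ} (hk : k < p) :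
    (k.factorial : ZMod p) ≠ 0 := by
  rw [Ne, ZMod.natCast_eq_zero_iff, (Fact.out : p.Prime).dvd_factorial]
  omega

theorem Ring.factorial_mul_choose_cast (R : Type*) [CommRing R] (x : ℤ) (k : ℕ) :
    (k.factorial : R) * (Ring.choose x k : ℤ) = (descPochhammer R k).eval (x : R) := by
  have h := congrArg (Int.cast (R := R)) (Ring.descPochhammer_eq_factorial_smul_choose x k)
  rw [← descPochhammer_map (Int.castRingHom R), eval_intCast_map]
  rw [← eval_eq_smeval, nsmul_eq_mul, Int.cast_mul, Int.cast_natCast] at h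
  exact h.symm

theorem Ring.choose_cast_zmod_congr {p : ℕ} [Fact p.Prime] {k : ℕ} (hk : k < p) {x y : ℤ}
    (h : (x : ZMod p) = y) : ((Ring.choose x k : ℤ) : ZMod p) = (Ring.choose y k : ℤ) := by
  apply mul_left_cancel₀ (ZMod.natCast_factorial_ne_zero hk)
  rw [factorial_mul_choose_cast, factorial_mul_choose_cast, h]

theorem ZMod.natCast_factorial_half_sq {p m : ℕ} [Fact p.Prime] (hm : 2 * m + 1 = p) :
    (m.factorial : ZMod p) ^ 2 = (-1) ^ (m + 1) := by
  have hc : ((2 * m).choose m : ZMod p) = (-1) ^ m := by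
    have h := Ring.choose_cast_zmod_congr (p := p) (k := m) (x := (2 * m : ℕ)) (y := -1)
      (by omega) (by
        have : ((2 * m + 1 : ℕ) : ZMod p) = 0 := by rw [hm, ZMod.natCast_self]
        push_cast at this ⊢
        linear_combination this)
    rw [Ring.choose_natCast, Ring.choose_neg] at h
    simpa [Units.smul_def, Ring.choose_natCast] using h
  have hf := Nat.choose_mul_factorial_mul_factorial (show m ≤ 2 * m by omega)
  have hw := ZMod.wilsons_lemma p
  rw [show p - 1 = 2 * m by omega, ← hf, show 2 * m - m = m by omega] at hw
  subst hm
  push_cast at hw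
  rw [hc] at hw
  have h1 : ((-1 : ZMod (2 * m + 1)) ^ m) * (-1) ^ m = 1 := by
    rw [← mul_pow]; simp
  linear_combination (-1) ^ m * hw - (m.factorial : ZMod (2 * m + 1)) ^ 2 * h1

/-- The Newton-basis polynomial taking the value `∑ k ≤ m, c k * n.choose k` at `n`. -/
noncomputable def newtonPolynomial {K : Type*} [Field K] (c : ℕ → K) (m : ℕ) : K[X] :=
  ∑ k ∈ Finset.range (m + 1), C (c k / k.factorial) * descPochhammer K k

section

variable {K : Type*} [Field K] (c : ℕ → K) (m : ℕ)

theorem natDegree_newtonPolynomial_le : (newtonPolynomial c m).natDegree ≤ m := by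
  refine natDegree_sum_le_of_forall_le _ _ fun k hk ↦ (natDegree_C_mul_le _ _).trans ?_
  rw [descPochhammer_natDegree]
  exact Finset.mem_range_succ_iff.mp hk

theorem coeff_newtonPolynomial : (newtonPolynomial c m).coeff m = c m / m.factorial := by
  rw [newtonPolynomial, finsetSum_coeff, Finset.sum_range_succ, Finset.sum_eq_zero, zero_add,
    coeff_C_mul]
  · have h := (monic_descPochhammer K m).coeff_natDegree
    rw [descPochhammer_natDegree] at h
    rw [h, mul_one]
  · intro k hk
    rw [coeff_C_mul, coeff_eq_zero_of_natDegree_lt, mul_zero]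
    rw [descPochhammer_natDegree]
    exact Finset.mem_range.mp hk

theorem eval_natCast_newtonPolynomial (hm : (m.factorial : K) ≠ 0) (n : ℕ) :
    (newtonPolynomial c m).eval (n : K) =
      ∑ k ∈ Finset.range (m + 1), c k * n.choose k := by
  rw [newtonPolynomial, eval_finsetSum]
  refine Finset.sum_congr rfl fun k hk ↦ ?_
  have hk0 : (k.factorial : K) ≠ 0 := fun h ↦ hm <| by
    obtain ⟨d, hd⟩ := Nat.factorial_dvd_factorial (Finset.mem_range_succ_iff.mp hk)
    rw [hd, Nat.cast_mul, h, zero_mul]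
  rw [eval_mul, eval_C, descPochhammer_eval_eq_descFactorial,
    Nat.descFactorial_eq_factorial_mul_choose]
  push_cast
  field_simp

end

theorem S_cast_eq_eval_newtonPolynomial {p m : ℕ} [Fact p.Prime] (hm : 2 * m + 1 = p)
    {n : ℕ} (hn : n < p) {x : ℤ} (hx : (x : ZMod p) = m) (y : ℤ) :
    (S n x y : ZMod p) =
      (newtonPolynomial (fun k ↦ (m.choose k : ZMod p) ^ 2 * (y : ZMod p) ^ k) m).eval
        (n : ZMod p) := by
  have hx' : ((-1 - x : ℤ) : ZMod p) = ((m : ℤ) : ZMod p) := by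
    have : ((2 * m + 1 : ℕ) : ZMod p) = 0 := by rw [hm, ZMod.natCast_self]
    push_cast at this ⊢
    rw [hx]
    linear_combination -this
  rw [eval_natCast_newtonPolynomial _ _ (ZMod.natCast_factorial_ne_zero (by omega)), S,
    Int.cast_sum]
  trans ∑ k ∈ Finset.range p, (m.choose k : ZMod p) ^ 2 * (y : ZMod p) ^ k * n.choose k
  · rw [← Finset.sum_subset (Finset.range_subset_range.mpr (show n + 1 ≤ p by omega))]
    · refine Finset.sum_congr rfl fun k hk ↦ ?_
      have hk : k < p := by have := Finset.mem_range.mp hk; omega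
      push_cast
      rw [Ring.choose_cast_zmod_congr hk (y := m) (by simpa using hx),
        Ring.choose_cast_zmod_congr hk hx', Ring.choose_natCast]
      push_cast
      ring
    · intro k _ hk
      rw [Nat.choose_eq_zero_of_lt (n := n) (by simpa using hk)]
      simp
  · refine (Finset.sum_subset (Finset.range_subset_range.mpr (by omega)) ?_).symm
    intro k _ hk
    rw [Nat.choose_eq_zero_of_lt (n := m) (by simpa using hk)]
    simp

theorem stmt_2 (p : ℕ) [Fact (Nat.Prime p)] (hodd : Odd p)
    (x₁ x₂ y₁ y₂ : ℤ)
    (hy₁ : ¬ (p : ℤ) ∣ y₁) (hy₂ : ¬ (p : ℤ) ∣ y₂)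
    (hx₁ : x₁ % p = ((p - 1) / 2 : ℕ)) (hx₂ : x₂ % p = ((p - 1) / 2 : ℕ)) :
    (∑ k ∈ Finset.range p, S k x₁ y₁ * S k x₂ y₂) ≡
      legendreSym p (-(y₁ * y₂)) [ZMOD p] := by
  obtain ⟨m, hm⟩ := hodd
  have hhalf : (p - 1) / 2 = m := by omega
  have hcast {x : ℤ} (hx : x % p = ((p - 1) / 2 : ℕ)) : (x : ZMod p) = m := by
    rw [← ZMod.intCast_mod, hx, hhalf, Int.cast_natCast]
  rw [← ZMod.intCast_eq_intCast_iff, legendreSym.eq_pow, show p / 2 = m by omega, Int.cast_sum]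
  set P : ℤ → (ZMod p)[X] := fun y ↦
    newtonPolynomial (fun k ↦ (m.choose k : ZMod p) ^ 2 * (y : ZMod p) ^ k) m
  have hdeg (y : ℤ) : (P y).natDegree ≤ m := natDegree_newtonPolynomial_le _ _
  have hcoeff (y : ℤ) : (P y).coeff m = (y : ZMod p) ^ m / m.factorial := by
    simp [P, coeff_newtonPolynomial]
  have hcard : Fintype.card (ZMod p) - 1 = m + m := by rw [ZMod.card]; omega
  calc ∑ n ∈ Finset.range p, ((S n x₁ y₁ * S n x₂ y₂ : ℤ) : ZMod p)
      = ∑ n ∈ Finset.range p, (P y₁ * P y₂).eval (n : ZMod p) :=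
        Finset.sum_congr rfl fun n hn ↦ by
          rw [Int.cast_mul, eval_mul,
            S_cast_eq_eval_newtonPolynomial hm.symm (Finset.mem_range.mp hn) (hcast hx₁),
            S_cast_eq_eval_newtonPolynomial hm.symm (Finset.mem_range.mp hn) (hcast hx₂)]
    _ = ∑ a : ZMod p, (P y₁ * P y₂).eval a :=
        ZMod.sum_range_natCast fun a ↦ (P y₁ * P y₂).eval a
    _ = -((P y₁).coeff m * (P y₂).coeff m) := by
        rw [FiniteField.sum_eval_of_natDegree_le, hcard,
          coeff_mul_add_eq_of_natDegree_le (hdeg y₁) (hdeg y₂)]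
        rw [hcard]
        exact natDegree_mul_le.trans (add_le_add (hdeg y₁) (hdeg y₂))
    _ = ((-(y₁ * y₂) : ℤ) : ZMod p) ^ m := by
        have hf := ZMod.natCast_factorial_half_sq hm.symm
        rw [hcoeff, hcoeff, div_mul_div_comm, ← sq, hf]
        push_cast
        rw [neg_pow ((y₁ : ZMod p) * y₂), mul_pow, pow_succ]
        rcases neg_one_pow_eq_or (ZMod p) m with h | h <;> simp [h, div_neg]
end

section
/- Let p be an odd prime and let a be a nonzero integer with gcd(a,p) = 1. Then, computing in ℤ/pℤ with a⁻¹ the inverse of a mod p, Σ_{n=0}^{p-1} (Σ_{k=0}^{n} C(n,k)·C_k·(a⁻¹)^k)² = 4·(-1/p) − (a+4)·(a(a+4)/p) + a + 1, where (·/p) is the Legendre symbol; here a(a+4)/a = a+4 replaces the expression δ/a with δ = a(a+4). -/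
open Polynomial in
theorem coeff_quadratic_pow_succ {R : Type*} [CommRing R] (q₀ q₁ q₂ : R) (n : ℕ) :
    ((C q₂ * X ^ 2 + C q₁ * X + C q₀) ^ (n + 1)).natDegree ≤ 2 * n + 2 ∧
    ((C q₂ * X ^ 2 + C q₁ * X + C q₀) ^ (n + 1)).coeff 0 = q₀ ^ (n + 1) ∧
    ((C q₂ * X ^ 2 + C q₁ * X + C q₀) ^ (n + 1)).coeff 1 = (n + 1) * q₁ * q₀ ^ n ∧
    ((C q₂ * X ^ 2 + C q₁ * X + C q₀) ^ (n + 1)).coeff (2 * n + 1) = (n + 1) * q₁ * q₂ ^ n ∧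
    ((C q₂ * X ^ 2 + C q₁ * X + C q₀) ^ (n + 1)).coeff (2 * n + 2) = q₂ ^ (n + 1) := by
  induction n with
  | zero =>
    refine ⟨?_, ?_, ?_, ?_, ?_⟩
    · simpa using natDegree_quadratic_le (a := q₂) (b := q₁) (c := q₀)
    all_goals simp [coeff_X, coeff_C]
  | succ n ih =>
    set Q : R[X] := C q₂ * X ^ 2 + C q₁ * X + C q₀ with hQ
    obtain ⟨hd, h0, h1, h2, h3⟩ := ih
    have hd2 : (Q ^ (n + 1)).coeff (2 * n + 3) = 0 :=
      coeff_eq_zero_of_natDegree_lt (by omega)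
    have hd3 : (Q ^ (n + 1)).coeff (2 * n + 4) = 0 :=
      coeff_eq_zero_of_natDegree_lt (by omega)
    have key : Q ^ (n + 1 + 1) =
        C q₂ * (X * (X * Q ^ (n + 1))) + C q₁ * (X * Q ^ (n + 1)) + C q₀ * Q ^ (n + 1) := by
      rw [pow_succ Q (n + 1)]
      nth_rw 2 [hQ]
      ring
    refine ⟨?_, ?_, ?_, ?_, ?_⟩
    · have : Q.natDegree ≤ 2 := natDegree_quadratic_le
      calc _ ≤ (n + 1 + 1) * 2 := natDegree_pow_le_of_le _ this
        _ = _ := by ring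
    · rw [key]; simp [h0]; ring
    · rw [key]; simp [h0, h1, coeff_X_mul]; ring
    · rw [key, show 2 * (n + 1) + 1 = 2 * n + 1 + 1 + 1 by ring]
      simp only [coeff_add, coeff_C_mul, coeff_X_mul, h2, h3, hd2]
      push_cast; ring
    · rw [key, show 2 * (n + 1) + 2 = 2 * n + 2 + 1 + 1 by ring]
      simp only [coeff_add, coeff_C_mul, coeff_X_mul, h3, hd2, hd3]
      ring

theorem ZMod.sum_pow_of_pos {p : ℕ} [Fact p.Prime] {i : ℕ} (hi : 0 < i) :
    ∑ y : ZMod p, y ^ i = if p - 1 ∣ i then -1 else 0 := by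
  have h := FiniteField.sum_pow_units (ZMod p) i
  rw [ZMod.card] at h
  rw [← h, Fintype.sum_eq_add_sum_compl 0, zero_pow hi.ne', zero_add]
  symm
  refine Finset.sum_bij (fun x _ => (x : ZMod p)) (by simp) (fun _ _ _ _ h => Units.ext h)
    (fun b hb => ?_) (fun _ _ => rfl)
  exact ⟨Units.mk0 b (by simpa using hb), by simp, rfl⟩

theorem ZMod.sum_range_pow_eq {p : ℕ} [Fact p.Prime] (u : ZMod p) :
    ∑ n ∈ Finset.range p, u ^ n = if u = 1 then 0 else 1 := by
  split_ifs with h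
  · simp [h]
  · rw [geom_sum_eq h, ZMod.pow_card, div_self (sub_ne_zero.2 h)]

theorem two_mul_catalan {R : Type*} [CommRing R] (k : ℕ) :
    2 * (catalan k : R) = 4 * (k.centralBinom : R) - ((k + 1).centralBinom : R) := by
  have h : 2 * catalan k + (k + 1).centralBinom = 4 * k.centralBinom := by
    have h1 := succ_mul_catalan_eq_centralBinom k
    have h2 := Nat.succ_mul_centralBinom_succ k
    apply Nat.eq_of_mul_eq_mul_left (Nat.succ_pos k)
    rw [← h1] at *
    nlinarith
  have := congrArg (Nat.cast : ℕ → R) h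
  push_cast at this
  linear_combination this

open Polynomial in
theorem ZMod.sum_inv_mul_eval {p : ℕ} [Fact p.Prime] {m : ℕ} (hp : p = 2 * m + 3)
    {P : (ZMod p)[X]} (hP : P.natDegree ≤ p + 1) :
    ∑ y : ZMod p, y⁻¹ * P.eval y = -(P.coeff 1 + P.coeff p) := by
  have hinv : ∀ y : ZMod p, y⁻¹ = y ^ (2 * m + 1) := fun y => by
    rcases eq_or_ne y 0 with rfl | hy
    · simp
    · have := ZMod.pow_card_sub_one_eq_one hy
      rw [show p - 1 = 2 * m + 1 + 1 by omega, pow_succ] at this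
      exact (eq_inv_of_mul_eq_one_left this).symm
  have hdvd : ∀ i ∈ Finset.range (p + 2), (p - 1 ∣ i + (2 * m + 1) ↔ i = 1 ∨ i = p) := by
    intro i hi
    rw [Finset.mem_range] at hi
    constructor
    · rintro ⟨c, hc⟩
      rw [hp, show 2 * m + 3 - 1 = 2 * m + 2 by omega] at hc
      rcases c with _ | _ | _ | c
      · omega
      · omega
      · omega
      · have : (2 * m + 2) * (c + 1 + 1 + 1) = 3 * (2 * m + 2) + (2 * m + 2) * c := by ring
        omega
    · rintro (rfl | rfl)
      · exact ⟨1, by omega⟩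
      · exact ⟨2, by omega⟩
  calc ∑ y : ZMod p, y⁻¹ * P.eval y
      = ∑ i ∈ Finset.range (p + 2), P.coeff i * ∑ y : ZMod p, y ^ (i + (2 * m + 1)) := by
        simp_rw [Finset.mul_sum]
        rw [Finset.sum_comm]
        refine Finset.sum_congr rfl fun y _ => ?_
        rw [eval_eq_sum_range' (Nat.lt_succ_of_le hP), Finset.mul_sum]
        refine Finset.sum_congr rfl fun i _ => ?_
        rw [hinv]
        ring
    _ = ∑ i ∈ Finset.range (p + 2),
          ((if i = 1 then -P.coeff i else 0) + if i = p then -P.coeff i else 0) := by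
        refine Finset.sum_congr rfl fun i hi => ?_
        rw [ZMod.sum_pow_of_pos (by omega)]
        simp only [hdvd i hi]
        have : 1 ≠ p := by omega
        by_cases h1 : i = 1 <;> by_cases h2 : i = p <;> simp [h1, h2] <;> omega
    _ = _ := by
        rw [Finset.sum_add_distrib, Finset.sum_ite_eq', Finset.sum_ite_eq',
          if_pos (by simp), if_pos (by simp)]
        ring

open Polynomial in
theorem ZMod.sum_inv_mul_quadratic_mul_pow {p : ℕ} [Fact p.Prime] {m : ℕ} (hp : p = 2 * m + 3)
    (w₀ w₁ w₂ q₀ q₁ q₂ : ZMod p) :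
    ∑ y : ZMod p, y⁻¹ * ((w₂ * y ^ 2 + w₁ * y + w₀) * (q₂ * y ^ 2 + q₁ * y + q₀) ^ (m + 1)) =
      -(w₀ * ((m + 1) * q₁ * q₀ ^ m) + w₁ * q₀ ^ (m + 1)
        + w₂ * ((m + 1) * q₁ * q₂ ^ m) + w₁ * q₂ ^ (m + 1)) := by
  obtain ⟨hd, h0, h1, h2, h3⟩ := coeff_quadratic_pow_succ q₀ q₁ q₂ m
  set R : (ZMod p)[X] := (C q₂ * X ^ 2 + C q₁ * X + C q₀) ^ (m + 1) with hR
  have h4 : R.coeff (2 * m + 3) = 0 := coeff_eq_zero_of_natDegree_lt (by omega)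
  have hdeg : ((C w₂ * X ^ 2 + C w₁ * X + C w₀) * R).natDegree ≤ p + 1 :=
    natDegree_mul_le.trans (by
      have : (C w₂ * X ^ 2 + C w₁ * X + C w₀).natDegree ≤ 2 := natDegree_quadratic_le
      omega)
  have key := ZMod.sum_inv_mul_eval hp hdeg
  have hexp : (C w₂ * X ^ 2 + C w₁ * X + C w₀) * R =
      C w₂ * (X * (X * R)) + C w₁ * (X * R) + C w₀ * R := by ring
  have c1 : ((C w₂ * X ^ 2 + C w₁ * X + C w₀) * R).coeff 1 =
      w₁ * q₀ ^ (m + 1) + w₀ * ((m + 1) * q₁ * q₀ ^ m) := by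
    rw [hexp]; simp [coeff_X_mul, h0, h1]
  have cp : ((C w₂ * X ^ 2 + C w₁ * X + C w₀) * R).coeff p =
      w₂ * ((m + 1) * q₁ * q₂ ^ m) + w₁ * q₂ ^ (m + 1) := by
    rw [hexp]
    refine (congrArg (coeff _) (show p = 2 * m + 1 + 1 + 1 from hp)).trans ?_
    simp only [coeff_add, coeff_C_mul, coeff_X_mul, h2, h3, h4]
    ring
  rw [c1, cp] at key
  simp only [hR, eval_mul, eval_add, eval_pow, eval_C, eval_X] at key
  rw [key]
  ring

theorem ZMod.two_mul_natCast_eq {p m : ℕ} (hp : p = 2 * m + 3) : (2 * m : ZMod p) = -3 := by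
  have : ((2 * m + 3 : ℕ) : ZMod p) = 0 := by rw [← hp, ZMod.natCast_self]
  push_cast at this
  linear_combination this

theorem ZMod.neg_four_pow_mul_choose_eq_centralBinom {p : ℕ} [Fact p.Prime] {m : ℕ}
    (hp : p = 2 * m + 3) {k : ℕ} (hk : k < p) :
    (-4 : ZMod p) ^ k * ((m + 1).choose k : ZMod p) = (k.centralBinom : ZMod p) := by
  induction k with
  | zero => simp
  | succ k ih =>
    have ih := ih (by omega)
    have hk0 : ((k + 1 : ℕ) : ZMod p) ≠ 0 := by
      rw [Ne, ZMod.natCast_eq_zero_iff]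
      exact Nat.not_dvd_of_pos_of_lt (Nat.succ_pos k) hk
    apply mul_left_cancel₀ hk0
    have h1 := congrArg (Nat.cast : ℕ → ZMod p) (Nat.succ_mul_centralBinom_succ k)
    have h2 : ((m + 1).choose (k + 1) : ZMod p) * (k + 1) =
        ((m + 1).choose k : ZMod p) * (m + 1 - k) := by
      rcases le_or_gt k (m + 1) with h | h
      · have := congrArg (Nat.cast : ℕ → ZMod p) (Nat.choose_succ_right_eq (m + 1) k)
        push_cast [Nat.cast_sub h] at this
        exact this
      · simp [Nat.choose_eq_zero_of_lt h, Nat.choose_eq_zero_of_lt (Nat.lt_succ_of_lt h)]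
    have hm := ZMod.two_mul_natCast_eq hp
    push_cast at h1 ⊢
    rw [h1, ← ih, pow_succ]
    linear_combination (-4 : ZMod p) ^ k * (-4) * h2
      - 2 * (-4 : ZMod p) ^ k * ((m + 1).choose k : ZMod p) * hm

theorem ZMod.centralBinom_self {p : ℕ} [Fact p.Prime] : (p.centralBinom : ZMod p) = 2 := by
  have hp := (Fact.out : p.Prime).pos
  have h := Choose.choose_modEq_choose_mod_mul_choose_div_nat (n := 2 * p) (k := p) (p := p)
  rw [Nat.mul_mod_left, Nat.mod_self, Nat.mul_div_cancel _ hp, Nat.div_self hp] at h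
  have := (ZMod.natCast_eq_natCast_iff _ _ _).2 h
  rw [Nat.centralBinom, this]
  simp

theorem ZMod.centralBinom_pred {p : ℕ} [Fact p.Prime] : ((p - 1).centralBinom : ZMod p) = 0 := by
  rw [← succ_mul_catalan_eq_centralBinom, Nat.sub_add_cancel (Fact.out : p.Prime).one_le]
  simp

theorem ZMod.sum_pow_mul_eq_centralBinom {p : ℕ} [Fact p.Prime] {m : ℕ}
    (hp : p = 2 * m + 3) {k : ℕ} (hk : k ≤ p) :
    ∑ t : ZMod p, (1 - (t * (t - 4)) ^ (m + 1)) * t ^ k = (k.centralBinom : ZMod p) := by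
  have hsum : ∑ t : ZMod p, (1 - (t * (t - 4)) ^ (m + 1)) * t ^ k =
      ∑ t : ZMod p, t ^ k - ∑ j ∈ Finset.range (m + 2),
        (-4) ^ j * ((m + 1).choose j : ZMod p) *
          if p - 1 ∣ k + (2 * m + 2 - j) then -1 else 0 := by
    have : ∀ j ∈ Finset.range (m + 2), (-4) ^ j * ((m + 1).choose j : ZMod p) *
        (if p - 1 ∣ k + (2 * m + 2 - j) then -1 else 0) =
        ∑ t : ZMod p, (-4) ^ j * ((m + 1).choose j : ZMod p) * t ^ (k + (2 * m + 2 - j)) := by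
      intro j hj
      rw [Finset.mem_range] at hj
      rw [← Finset.mul_sum, ZMod.sum_pow_of_pos (by omega)]
    rw [Finset.sum_congr rfl this, Finset.sum_comm, ← Finset.sum_sub_distrib]
    refine Finset.sum_congr rfl fun t _ => ?_
    rw [mul_pow, sub_eq_neg_add t 4, add_pow, sub_mul, one_mul, Finset.mul_sum, Finset.sum_mul]
    congr 1
    refine Finset.sum_congr rfl fun j hj => ?_
    rw [Finset.mem_range] at hj
    rw [show k + (2 * m + 2 - j) = k + (m + 1) + (m + 1 - j) by omega]
    ring
  rw [hsum]
  rcases lt_trichotomy k (p - 1) with h | rfl | h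
  · rw [FiniteField.sum_pow_lt_card_sub_one _ _ (by rwa [ZMod.card]),
      ← ZMod.neg_four_pow_mul_choose_eq_centralBinom hp (by omega)]
    have : ∀ j ∈ Finset.range (m + 2), (-4) ^ j * ((m + 1).choose j : ZMod p) *
        (if p - 1 ∣ k + (2 * m + 2 - j) then -1 else 0) =
        if j = k then -((-4) ^ j * ((m + 1).choose j : ZMod p)) else 0 := by
      intro j hj
      rw [Finset.mem_range] at hj
      have : p - 1 ∣ k + (2 * m + 2 - j) ↔ j = k := by
        constructor
        · rintro ⟨c, hc⟩
          rw [hp, show 2 * m + 3 - 1 = 2 * m + 2 by omega] at hc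
          rcases c with _ | _ | c
          · omega
          · omega
          · have : (2 * m + 2) * (c + 1 + 1) = 2 * (2 * m + 2) + (2 * m + 2) * c := by ring
            omega
        · rintro rfl
          exact ⟨1, by omega⟩
      simp only [this, mul_ite, mul_neg, mul_one, mul_zero]
    rw [Finset.sum_congr rfl this, Finset.sum_ite_eq']
    split_ifs with hk'
    · ring
    · rw [Nat.choose_eq_zero_of_lt (by rw [Finset.mem_range] at hk'; omega)]
      simp
  · rw [ZMod.centralBinom_pred, ZMod.sum_pow_of_pos (by omega), if_pos dvd_rfl,
      Finset.sum_eq_single 0]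
    · rw [if_pos ⟨2, by omega⟩]
      simp
    · intro j hj hj0
      rw [Finset.mem_range] at hj
      rw [if_neg, mul_zero]
      rintro ⟨c, hc⟩
      rw [hp, show 2 * m + 3 - 1 = 2 * m + 2 by omega] at hc
      rcases c with _ | _ | c
      · omega
      · omega
      · have : (2 * m + 2) * (c + 1 + 1) = 2 * (2 * m + 2) + (2 * m + 2) * c := by ring
        omega
    · simp
  · obtain rfl : k = p := by omega
    have hndvd : ¬ k - 1 ∣ k := by
      rintro ⟨c, hc⟩
      rw [show k - 1 = 2 * m + 2 by omega] at hc
      rcases c with _ | _ | c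
      · omega
      · omega
      · have : (2 * m + 2) * (c + 1 + 1) = 2 * (2 * m + 2) + (2 * m + 2) * c := by ring
        omega
    rw [ZMod.centralBinom_self, ZMod.sum_pow_of_pos (by omega), if_neg hndvd,
      Finset.sum_eq_single 1]
    · rw [if_pos ⟨2, by omega⟩]
      have := ZMod.two_mul_natCast_eq hp
      push_cast [Nat.choose_one_right]
      linear_combination -2 * this
    · intro j hj hj0
      rw [Finset.mem_range] at hj
      rw [if_neg, mul_zero]
      rintro ⟨c, hc⟩
      rw [show k - 1 = 2 * m + 2 by omega] at hc
      rcases c with _ | _ | _ | c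
      · omega
      · omega
      · omega
      · have : (2 * m + 2) * (c + 1 + 1 + 1) = 3 * (2 * m + 2) + (2 * m + 2) * c := by ring
        omega
    · simp

theorem ZMod.sum_pow_mul_eq_two_mul_catalan {p : ℕ} [Fact p.Prime] {m : ℕ}
    (hp : p = 2 * m + 3) {k : ℕ} (hk : k < p) :
    ∑ t : ZMod p, (4 - t) * (1 - (t * (t - 4)) ^ (m + 1)) * t ^ k = 2 * (catalan k : ZMod p) := by
  rw [two_mul_catalan, ← ZMod.sum_pow_mul_eq_centralBinom hp hk.le,
    ← ZMod.sum_pow_mul_eq_centralBinom (k := k + 1) hp hk, Finset.mul_sum, ← Finset.sum_sub_distrib]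
  exact Finset.sum_congr rfl fun t _ => by ring

theorem ZMod.sum_sq_sum_mul_pow {p : ℕ} [Fact p.Prime] (σ : ZMod p → ZMod p) :
    ∑ n ∈ Finset.range p, (∑ y, σ y * y ^ n) ^ 2 =
      (∑ y, σ y) ^ 2 - ∑ y, if y = 0 then 0 else σ y * σ y⁻¹ := by
  have hinv : ∀ y : ZMod p, (if y = 0 then 0 else σ y * σ y⁻¹) =
      ∑ z, if y * z = 1 then σ y * σ z else 0 := fun y => by
    split_ifs with h
    · simp [h]
    · simp only [mul_eq_one_iff_inv_eq₀ h]
      simp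
  simp_rw [hinv, sq, Finset.sum_mul_sum]
  rw [Finset.sum_comm, ← Finset.sum_sub_distrib]
  refine Finset.sum_congr rfl fun y _ => ?_
  rw [Finset.sum_comm, ← Finset.sum_sub_distrib]
  refine Finset.sum_congr rfl fun z _ => ?_
  calc ∑ n ∈ Finset.range p, σ y * y ^ n * (σ z * z ^ n)
      = σ y * σ z * ∑ n ∈ Finset.range p, (y * z) ^ n := by
        rw [Finset.mul_sum]
        exact Finset.sum_congr rfl fun n _ => by ring
    _ = _ := by
        rw [ZMod.sum_range_pow_eq]
        split_ifs <;> ring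

theorem ZMod.two_mul_sum_choose_mul_catalan {p : ℕ} [Fact p.Prime] {m : ℕ}
    (hp : p = 2 * m + 3) {a : ZMod p} (ha : a ≠ 0) {n : ℕ} (hn : n < p) :
    2 * ∑ k ∈ Finset.range (n + 1), (n.choose k : ZMod p) * (catalan k : ZMod p) * a⁻¹ ^ k =
      ∑ y : ZMod p, (a + 4 - a * y) *
        (1 - (a * (y - 1) * (a * y - (a + 4))) ^ (m + 1)) * y ^ n := by
  calc _ = ∑ k ∈ Finset.range (n + 1), ∑ t : ZMod p,
        (n.choose k : ZMod p) * a⁻¹ ^ k * ((4 - t) * (1 - (t * (t - 4)) ^ (m + 1)) * t ^ k) := by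
        rw [Finset.mul_sum]
        refine Finset.sum_congr rfl fun k hk => ?_
        rw [Finset.mem_range] at hk
        rw [← Finset.mul_sum, ZMod.sum_pow_mul_eq_two_mul_catalan hp (by omega)]
        ring
    _ = ∑ t : ZMod p, (4 - t) * (1 - (t * (t - 4)) ^ (m + 1)) * (a⁻¹ * t + 1) ^ n := by
        rw [Finset.sum_comm]
        refine Finset.sum_congr rfl fun t _ => ?_
        rw [add_pow, Finset.mul_sum]
        exact Finset.sum_congr rfl fun k _ => by ring
    _ = _ := by
        refine (Fintype.sum_bijective (fun y : ZMod p => a * (y - 1)) ?_ _ _ fun y => ?_).symm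
        · rw [← Finite.injective_iff_bijective]
          intro x y h
          simpa [ha] using h
        · rw [inv_mul_cancel_left₀ ha, sub_add_cancel,
            show a * (y - 1) - 4 = a * y - (a + 4) by ring,
            show 4 - a * (y - 1) = a + 4 - a * y by ring]

theorem ZMod.pow_eq_one_of_ne_zero {p : ℕ} [Fact p.Prime] {m : ℕ} (hp : p = 2 * m + 3)
    {x : ZMod p} (hx : x ≠ 0) : (x ^ 2) ^ (m + 1) = 1 := by
  rw [← pow_mul, show 2 * (m + 1) = p - 1 by omega, ZMod.pow_card_sub_one_eq_one hx]

theorem ZMod.weight_mul_weight_inv {p : ℕ} [Fact p.Prime] {m : ℕ} (hp : p = 2 * m + 3)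
    {a : ZMod p} (ha : a ≠ 0) (b y : ZMod p) :
    (if y = 0 then 0 else
      (b - a * y) * (1 - (a * (y - 1) * (a * y - b)) ^ (m + 1)) *
      ((b - a * y⁻¹) * (1 - (a * (y⁻¹ - 1) * (a * y⁻¹ - b)) ^ (m + 1)))) =
    y⁻¹ * (((-(a * b)) * y ^ 2 + (a ^ 2 + b ^ 2) * y + -(a * b)) * (0 * y ^ 2 + 0 * y + 1) ^ (m + 1))
    - y⁻¹ * (((-(a * b)) * y ^ 2 + (a ^ 2 + b ^ 2) * y + -(a * b)) *
        (a ^ 2 * y ^ 2 + -(a * (a + b)) * y + a * b) ^ (m + 1))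
    - y⁻¹ * (((-(a * b)) * y ^ 2 + (a ^ 2 + b ^ 2) * y + -(a * b)) *
        (a * b * y ^ 2 + -(a * (a + b)) * y + a ^ 2) ^ (m + 1))
    + y⁻¹ * (((-(a * b)) * y ^ 2 + (a ^ 2 + b ^ 2) * y + -(a * b)) *
        (a * b * y ^ 2 + -(a ^ 2 + b ^ 2) * y + a * b) ^ (m + 1))
    - if y = 1 then (b - a) ^ 2 * (-(b - a) ^ 2) ^ (m + 1) else 0 := by
  rcases eq_or_ne y 0 with rfl | hy
  · simp
  rw [if_neg hy]
  have hB : a * (y - 1) * (a * y - b) = a ^ 2 * y ^ 2 + -(a * (a + b)) * y + a * b := by ring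
  have hC : (a * (y⁻¹ - 1) * (a * y⁻¹ - b)) ^ (m + 1) =
      (a * b * y ^ 2 + -(a * (a + b)) * y + a ^ 2) ^ (m + 1) := by
    rw [show a * (y⁻¹ - 1) * (a * y⁻¹ - b) =
        (a * b * y ^ 2 + -(a * (a + b)) * y + a ^ 2) * y⁻¹ ^ 2 by field_simp; ring,
      mul_pow, ZMod.pow_eq_one_of_ne_zero hp (inv_ne_zero hy), mul_one]
  have hW : (b - a * y) * (b - a * y⁻¹) =
      y⁻¹ * ((-(a * b)) * y ^ 2 + (a ^ 2 + b ^ 2) * y + -(a * b)) := by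
    field_simp
    ring
  have hD : (a ^ 2 * y ^ 2 + -(a * (a + b)) * y + a * b) ^ (m + 1) *
      (a * b * y ^ 2 + -(a * (a + b)) * y + a ^ 2) ^ (m + 1) =
      if y = 1 then 0 else (a * b * y ^ 2 + -(a ^ 2 + b ^ 2) * y + a * b) ^ (m + 1) := by
    split_ifs with h
    · rw [h, show a ^ 2 * 1 ^ 2 + -(a * (a + b)) * 1 + a * b = 0 by ring]
      simp
    · rw [← mul_pow, show (a ^ 2 * y ^ 2 + -(a * (a + b)) * y + a * b) *
          (a * b * y ^ 2 + -(a * (a + b)) * y + a ^ 2) =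
          (a * b * y ^ 2 + -(a ^ 2 + b ^ 2) * y + a * b) * (a * (y - 1)) ^ 2 by ring,
        mul_pow, ZMod.pow_eq_one_of_ne_zero hp (mul_ne_zero ha (sub_ne_zero.2 h)), mul_one]
  rw [hB, hC]
  split_ifs at hD ⊢ with h
  · subst h
    rw [show (-(b - a) ^ 2) = a * b * 1 ^ 2 + -(a ^ 2 + b ^ 2) * 1 + a * b by ring]
    generalize (a ^ 2 * 1 ^ 2 + -(a * (a + b)) * 1 + a * b) ^ (m + 1) = B at *
    generalize (a * b * 1 ^ 2 + -(a * (a + b)) * 1 + a ^ 2) ^ (m + 1) = C at *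
    generalize (a * b * 1 ^ 2 + -(a ^ 2 + b ^ 2) * 1 + a * b) ^ (m + 1) = D at *
    simp only [inv_one, zero_mul, zero_add, one_pow] at *
    linear_combination (b - a) ^ 2 * hD
  · generalize (a ^ 2 * y ^ 2 + -(a * (a + b)) * y + a * b) ^ (m + 1) = B at *
    generalize (a * b * y ^ 2 + -(a * (a + b)) * y + a ^ 2) ^ (m + 1) = C at *
    generalize (a * b * y ^ 2 + -(a ^ 2 + b ^ 2) * y + a * b) ^ (m + 1) = D at *
    simp only [zero_mul, zero_add, one_pow] at *
    linear_combination (1 - B) * (1 - C) * hW +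
      y⁻¹ * ((-(a * b)) * y ^ 2 + (a ^ 2 + b ^ 2) * y + -(a * b)) * hD

theorem ZMod.sum_sq_sum_choose_mul_catalan {p : ℕ} [Fact p.Prime] {m : ℕ} (hp : p = 2 * m + 3)
    {a : ZMod p} (ha : a ≠ 0) :
    ∑ n ∈ Finset.range p,
        (∑ k ∈ Finset.range (n + 1),
          (n.choose k : ZMod p) * (catalan k : ZMod p) * a⁻¹ ^ k) ^ 2 =
      4 * (-1) ^ (m + 1) - (a + 4) * (a * (a + 4)) ^ (m + 1) + a + 1 := by
  have h2 : (2 : ZMod p) ≠ 0 := by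
    have : ((2 : ℕ) : ZMod p) ≠ 0 := by
      rw [Ne, ZMod.natCast_eq_zero_iff]
      exact Nat.not_dvd_of_pos_of_lt two_pos (by omega)
    exact_mod_cast this
  have hfour : (-(4 : ZMod p) ^ 2) ^ (m + 1) = (-1) ^ (m + 1) := by
    rw [neg_pow, ZMod.pow_eq_one_of_ne_zero hp, mul_one]
    rw [show (4 : ZMod p) = 2 * 2 by norm_num]
    exact mul_ne_zero h2 h2
  have hσ0 := ZMod.two_mul_sum_choose_mul_catalan hp ha (n := 0) (by omega)
  simp only [pow_zero, mul_one] at hσ0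
  have hS : 4 * ∑ n ∈ Finset.range p, (∑ k ∈ Finset.range (n + 1),
      (n.choose k : ZMod p) * (catalan k : ZMod p) * a⁻¹ ^ k) ^ 2 =
      ∑ n ∈ Finset.range p, (∑ y : ZMod p, (a + 4 - a * y) *
        (1 - (a * (y - 1) * (a * y - (a + 4))) ^ (m + 1)) * y ^ n) ^ 2 := by
    rw [Finset.mul_sum]
    refine Finset.sum_congr rfl fun n hn => ?_
    rw [← ZMod.two_mul_sum_choose_mul_catalan hp ha (Finset.mem_range.1 hn)]
    ring
  rw [ZMod.sum_sq_sum_mul_pow, ← hσ0] at hS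
  simp only [ZMod.weight_mul_weight_inv hp ha] at hS
  rw [Finset.sum_sub_distrib, Finset.sum_add_distrib, Finset.sum_sub_distrib,
    Finset.sum_sub_distrib] at hS
  simp only [ZMod.sum_inv_mul_quadratic_mul_pow hp, Finset.sum_ite_eq', Finset.mem_univ, if_true,
    add_sub_cancel_left, hfour] at hS
  have hm := ZMod.two_mul_natCast_eq hp
  have ha2 := ZMod.pow_eq_one_of_ne_zero hp ha
  apply mul_left_cancel₀ (mul_ne_zero h2 h2)
  rw [show (2 : ZMod p) * 2 = 4 by norm_num, hS]
  simp only [zero_add, Finset.range_one, Finset.sum_singleton, Nat.choose_self, Nat.cast_one,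
    catalan_zero, pow_zero, mul_one, one_pow, mul_zero, add_zero, zero_pow (Nat.succ_ne_zero m)]
  rw [pow_succ] at ha2
  rw [pow_succ (a * (a + 4)), pow_succ (a ^ 2)]
  generalize (a * (a + 4)) ^ m = u at *
  generalize (a ^ 2) ^ m = v at *
  generalize (-1 : ZMod p) ^ (m + 1) = e at *
  linear_combination ((a + 4) * (a + (a + 4)) - 2 * (a ^ 2 + (a + 4) ^ 2)) * ha2
    + (-(a ^ 2 * (a + 4) * (a + (a + 4)) * (u + v))
      + a * (a + 4) * (a ^ 2 + (a + 4) ^ 2) * u) * hm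

theorem stmt_4 (p : ℕ) [Fact (Nat.Prime p)] (hodd : Odd p)
    (a : ℤ) (ha : a ≠ 0) (hap : Int.gcd a p = 1) :
    ∑ n ∈ Finset.range p,
        (∑ k ∈ Finset.range (n + 1),
          (n.choose k : ZMod p) * (catalan k : ZMod p) * ((a : ZMod p)⁻¹) ^ k) ^ 2 =
      4 * (legendreSym p (-1) : ZMod p)
        - ((a : ZMod p) + 4) * (legendreSym p (a * (a + 4)) : ZMod p)
        + (a : ZMod p) + 1 := by
  obtain ⟨m, hm⟩ : ∃ m, p = 2 * m + 3 := by
    obtain ⟨j, hj⟩ := hodd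
    have := (Fact.out : p.Prime).two_le
    exact ⟨j - 1, by omega⟩
  have ha0 : (a : ZMod p) ≠ 0 := by
    rw [Ne, ZMod.intCast_zmod_eq_zero_iff_dvd]
    intro h
    rw [Int.gcd_comm, Int.gcd_eq_natAbs_left h] at hap
    have := (Fact.out : p.Prime).two_le
    omega
  rw [ZMod.sum_sq_sum_choose_mul_catalan hm ha0, legendreSym.eq_pow, legendreSym.eq_pow,
    show p / 2 = m + 1 by omega]
  push_cast
  ring
end

section
/- Let p be a prime with p ≡ 1 (mod 3), let a, b be integers, and let x₁, x₂ be integers with 2x₁ + 1 ≡ 0 (mod p) and 3x₂ + 1 ≡ 0 (mod p). Then p divides Σ_{n=0}^{p-1} D_n(x₁,a)·D_n(x₂,b). -/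
open Polynomial in
/-- The sum of the values of a polynomial of degree `< p - 1` over `ZMod p` vanishes. -/
theorem sum_range_eval_eq_zero_of_natDegree_lt {p : ℕ} [Fact p.Prime] (F : (ZMod p)[X])
    (hF : F.natDegree < p - 1) : ∑ n ∈ Finset.range p, F.eval (n : ZMod p) = 0 := by
  have h : ∑ n ∈ Finset.range p, F.eval (n : ZMod p) = ∑ x : ZMod p, F.eval x := by
    refine Finset.sum_nbij' (fun n => (n : ZMod p)) ZMod.val ?_ ?_ ?_ ?_ ?_
    · simp
    · intro x _
      simpa using ZMod.val_lt x
    · intro n hn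
      exact ZMod.val_cast_of_lt (Finset.mem_range.mp hn)
    · intro x _
      exact ZMod.natCast_zmod_val x
    · simp
  rw [h]
  simp_rw [eval_eq_sum_range]
  rw [Finset.sum_comm]
  refine Finset.sum_eq_zero fun i hi => ?_
  rw [← Finset.mul_sum, FiniteField.sum_pow_lt_card_sub_one, mul_zero]
  rw [ZMod.card]
  have := Finset.mem_range.mp hi
  omega

theorem natCast_factorial_ne_zero_of_lt {p k : ℕ} [hp : Fact p.Prime] (hk : k < p) :
    (k.factorial : ZMod p) ≠ 0 := by
  rw [Ne, ZMod.natCast_eq_zero_iff, hp.out.dvd_factorial]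
  omega

/-- For `k < p`, the residue of `Ring.choose x k` modulo `p` depends only on that of `x`. -/
theorem ringChoose_cast_eq_natChoose {p k m : ℕ} [Fact p.Prime] (hk : k < p) {x : ℤ}
    (hx : (x : ZMod p) = m) : ((Ring.choose x k : ℤ) : ZMod p) = m.choose k := by
  apply mul_left_cancel₀ (natCast_factorial_ne_zero_of_lt hk)
  have h := Ring.descPochhammer_eq_factorial_smul_choose x k
  rw [← Polynomial.eval_eq_smeval, nsmul_eq_mul] at h
  have h' := congrArg (Int.castRingHom (ZMod p)) h
  rw [← Polynomial.eval_map_apply, descPochhammer_map] at h'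
  simp only [eq_intCast, hx, Int.cast_mul, Int.cast_natCast,
    descPochhammer_eval_eq_descFactorial] at h'
  rw [← h', Nat.descFactorial_eq_factorial_mul_choose, Nat.cast_mul]

open Polynomial in
/-- If `x ≡ m` modulo `p` with `m < p`, then `n ↦ D n x y` agrees modulo `p` on `n < p` with a
polynomial of degree at most `m`. -/
theorem exists_polynomial_D_cast {p m : ℕ} [Fact p.Prime] (hm : m < p) {x : ℤ}
    (hx : (x : ZMod p) = m) (y : ℤ) :
    ∃ F : (ZMod p)[X], F.natDegree ≤ m ∧
      ∀ n < p, ((D n x y : ℤ) : ZMod p) = F.eval (n : ZMod p) := by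
  refine ⟨∑ k ∈ Finset.range (m + 1),
    C ((m.choose k : ZMod p) * (y : ZMod p) ^ k * (k.factorial : ZMod p)⁻¹) *
      descPochhammer (ZMod p) k, ?_, fun n hn => ?_⟩
  · refine natDegree_sum_le_of_forall_le _ _ fun k hk => (natDegree_C_mul_le _ _).trans ?_
    rw [descPochhammer_natDegree]
    exact Nat.lt_succ_iff.mp (Finset.mem_range.mp hk)
  · have h₁ : ((D n x y : ℤ) : ZMod p) =
        ∑ k ∈ Finset.range p, (n.choose k : ZMod p) * m.choose k * (y : ZMod p) ^ k := by
      rw [D, Int.cast_sum]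
      rw [← Finset.sum_subset (Finset.range_subset_range.mpr (Nat.succ_le_of_lt hn))]
      · refine Finset.sum_congr rfl fun k hk => ?_
        have hk' := Finset.mem_range.mp hk
        push_cast
        rw [ringChoose_cast_eq_natChoose (by omega) hx]
      · intro k _ hk
        rw [Nat.choose_eq_zero_of_lt (by simp at hk; omega)]
        simp
    rw [h₁, eval_finsetSum,
      ← Finset.sum_subset (Finset.range_subset_range.mpr (Nat.succ_le_of_lt hm))]
    · refine Finset.sum_congr rfl fun k hk => ?_
      have hk' := Finset.mem_range.mp hk
      have h0 := natCast_factorial_ne_zero_of_lt (p := p) (k := k) (by omega)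
      rw [eval_C_mul, descPochhammer_eval_eq_descFactorial,
        Nat.descFactorial_eq_factorial_mul_choose, Nat.cast_mul]
      field_simp
    · intro k _ hk
      rw [Nat.choose_eq_zero_of_lt (n := m) (by simp at hk; omega)]
      simp

/-- If `d * m + 1 = p` and `p ∣ d * x + 1`, then `x ≡ m` modulo `p`. -/
theorem intCast_eq_natCast_of_dvd {p d m : ℕ} [hp : Fact p.Prime] (hd : d * m + 1 = p) {x : ℤ}
    (hx : (p : ℤ) ∣ d * x + 1) : (x : ZMod p) = m := by
  have h₁ := (ZMod.intCast_zmod_eq_zero_iff_dvd _ p).mpr hx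
  have h₂ : ((d * m + 1 : ℕ) : ZMod p) = 0 := by rw [hd]; exact ZMod.natCast_self p
  push_cast at h₁ h₂
  have hd0 : (d : ZMod p) ≠ 0 := by
    intro h
    simp [h] at h₂
  exact mul_left_cancel₀ hd0 (by linear_combination h₁ - h₂)

theorem stmt_7 (p : ℕ) (hp : p.Prime) (hmod : p % 3 = 1)
    (a b x₁ x₂ : ℤ)
    (hx₁ : (p : ℤ) ∣ 2 * x₁ + 1) (hx₂ : (p : ℤ) ∣ 3 * x₂ + 1) :
    (p : ℤ) ∣ ∑ n ∈ Finset.range p, D n x₁ a * D n x₂ b := by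
  have : Fact p.Prime := ⟨hp⟩
  have hodd : p % 2 = 1 := hp.eq_two_or_odd.resolve_left (by omega)
  have hp2 := hp.two_le
  obtain ⟨F, hF, hF'⟩ := exists_polynomial_D_cast (p := p) (m := (p - 1) / 2) (by omega)
    (intCast_eq_natCast_of_dvd (d := 2) (by omega) (by exact_mod_cast hx₁)) a
  obtain ⟨G, hG, hG'⟩ := exists_polynomial_D_cast (p := p) (m := (p - 1) / 3) (by omega)
    (intCast_eq_natCast_of_dvd (d := 3) (by omega) (by exact_mod_cast hx₂)) b
  rw [← ZMod.intCast_zmod_eq_zero_iff_dvd, Int.cast_sum,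
    ← sum_range_eval_eq_zero_of_natDegree_lt (F * G)
      (Polynomial.natDegree_mul_le.trans_lt (by omega))]
  refine Finset.sum_congr rfl fun n hn => ?_
  rw [Int.cast_mul, hF' n (Finset.mem_range.mp hn), hG' n (Finset.mem_range.mp hn),
    Polynomial.eval_mul]
end

section
/- For every natural number n and all rational numbers x and y, Σ_{k=0}^{n} C(n,k)·Ch(x,k)·y^k = Σ_{k=0}^{n} C(n,k)·Ch(x+k,k)·y^k·(1-y)^{n-k}. -/
/-- The `j`-th factorial moment identity for the binomial expansion of `(y + z) ^ (j + m)`. -/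
theorem sum_choose_mul_choose_mul_pow {R : Type*} [CommSemiring R] (j m : ℕ) (y z : R) :
    ∑ k ∈ Finset.range (j + m + 1),
        ((j + m).choose k : R) * (k.choose j : R) * y ^ k * z ^ (j + m - k) =
      ((j + m).choose j : R) * y ^ j * (y + z) ^ m := by
  rw [add_assoc, Finset.sum_range_add, Finset.sum_eq_zero, zero_add, add_pow, Finset.mul_sum]
  · refine Finset.sum_congr rfl fun i _ => ?_
    have h := Nat.choose_mul (n := j + m) (k := j + i) (s := j) (Nat.le_add_right j i)
    rw [Nat.add_sub_cancel_left, Nat.add_sub_cancel_left] at h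
    rw [← Nat.cast_mul, h, Nat.add_sub_add_left]
    push_cast
    ring
  · intro k hk
    simp [Nat.choose_eq_zero_of_lt (Finset.mem_range.mp hk)]

/-- Vandermonde's identity for `Ring.choose (x + k) k`, summed over any range containing `k`. -/
theorem Ring.choose_add_natCast_self {R : Type*} [CommRing R] [BinomialRing R] (x : R)
    {k n : ℕ} (hkn : k ≤ n) :
    Ring.choose (x + k) k = ∑ j ∈ Finset.range (n + 1), (k.choose j : R) * Ring.choose x j := by
  rw [Ring.add_choose_eq k (Commute.all x (k : R)),
    Finset.Nat.sum_antidiagonal_eq_sum_range_succ_mk]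
  refine Finset.sum_subset_zero_on_sdiff (by simpa using hkn) ?_ ?_
  · intro j hj
    have hkj : k < j := by simp at hj; omega
    simp [Nat.choose_eq_zero_of_lt hkj]
  · intro j hj
    have hjk : j ≤ k := by simp at hj; omega
    rw [Ring.choose_natCast, Nat.choose_symm hjk, mul_comm]

theorem stmt_9 (n : ℕ) (x y : ℚ) :
    ∑ k ∈ Finset.range (n + 1), (n.choose k : ℚ) * Ring.choose x k * y ^ k =
      ∑ k ∈ Finset.range (n + 1),
        (n.choose k : ℚ) * Ring.choose (x + k) k * y ^ k * (1 - y) ^ (n - k) := by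
  symm
  calc
    _ = ∑ k ∈ Finset.range (n + 1), ∑ j ∈ Finset.range (n + 1),
          Ring.choose x j *
            ((n.choose k : ℚ) * (k.choose j : ℚ) * y ^ k * (1 - y) ^ (n - k)) := by
      refine Finset.sum_congr rfl fun k hk => ?_
      rw [Ring.choose_add_natCast_self x (Finset.mem_range_succ_iff.mp hk), Finset.mul_sum,
        Finset.sum_mul, Finset.sum_mul]
      exact Finset.sum_congr rfl fun j _ => by ring
    _ = _ := by
      rw [Finset.sum_comm]
      refine Finset.sum_congr rfl fun j hj => ?_
      obtain ⟨m, rfl⟩ := Nat.exists_eq_add_of_le (Finset.mem_range_succ_iff.mp hj)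
      rw [← Finset.mul_sum, sum_choose_mul_choose_mul_pow, add_sub_cancel, one_pow]
      ring
end

section
/- Let n be a positive integer and let i, j be natural numbers with i ≤ n-1 and j ≤ n-1. Then (i+j+1) · Σ_{k=0}^{n-1} C(k,i)·C(k+j,j) = (n-i)·C(n,i)·C(n+j,j), an identity of natural numbers; equivalently, Σ_{k=0}^{n-1} C(k,i)·C(k+j,j) = (-1)^j · n/(i+j+1) · C(n-1,i) · Ch(-n-1,j), where Ch(-n-1,j) is the integer-valued binomial coefficient (-n-1)(-n-2)⋯(-n-j)/j!. -/
theorem add_add_one_mul_sum_choose_mul_choose (n i j : ℕ) :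
    (i + j + 1) * ∑ k ∈ Finset.range n, k.choose i * (k + j).choose j =
      (i + 1) * n.choose (i + 1) * (n + j).choose j := by
  induction n with
  | zero => simp
  | succ n ih =>
    rw [Finset.sum_range_succ, mul_add, ih]
    have h1 : (n + 1) * n.choose i = (n + 1).choose (i + 1) * (i + 1) :=
      Nat.add_one_mul_choose_eq n i
    have h2 : (n + 1).choose (i + 1) = n.choose i + n.choose (i + 1) :=
      Nat.choose_succ_succ n i
    have h3 : (n + j + 1) * (n + j).choose j = (n + 1 + j).choose j * (n + 1) := by
      have h := Nat.add_one_mul_choose_eq (n + j) n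
      rw [Nat.choose_symm_add, show n + j + 1 = (n + 1) + j by ring, Nat.choose_symm_add] at h
      rw [← h]
      ring
    have h4 : (i + 1) * n.choose (i + 1) + (i + 1) * n.choose i = (n + 1) * n.choose i := by
      rw [h1, h2]
      ring
    calc (i + 1) * n.choose (i + 1) * (n + j).choose j +
          (i + j + 1) * (n.choose i * (n + j).choose j)
        = ((i + 1) * n.choose (i + 1) + (i + 1) * n.choose i) * (n + j).choose j +
            j * n.choose i * (n + j).choose j := by ring
      _ = n.choose i * ((n + j + 1) * (n + j).choose j) := by rw [h4]; ring
      _ = (n + 1) * n.choose i * (n + 1 + j).choose j := by rw [h3]; ring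
      _ = (i + 1) * (n + 1).choose (i + 1) * (n + 1 + j).choose j := by rw [h1]; ring

theorem Int.ringChoose_neg_sub_one (n j : ℕ) :
    Ring.choose (-(n : ℤ) - 1) j = (-1) ^ j * ((n + j).choose j : ℤ) := by
  rw [show -(n : ℤ) - 1 = -((n + 1 : ℕ) : ℤ) by push_cast; ring, Ring.choose_neg,
    show ((n + 1 : ℕ) : ℤ) + j - 1 = ((n + j : ℕ) : ℤ) by push_cast; ring,
    Ring.choose_natCast]
  simp [Int.negOnePow_def, Units.smul_def]

theorem stmt_10 (n : ℕ) (hn : 0 < n) (i j : ℕ) (hi : i ≤ n - 1) (hj : j ≤ n - 1) :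
    (i + j + 1) * ∑ k ∈ Finset.range n, k.choose i * (k + j).choose j =
      (n - i) * n.choose i * (n + j).choose j ∧
    (∑ k ∈ Finset.range n, (k.choose i : ℚ) * ((k + j).choose j : ℚ)) =
      (-1) ^ j * (n : ℚ) / (i + j + 1) * ((n - 1).choose i : ℚ) *
        ((Ring.choose (-(n : ℤ) - 1) j : ℤ) : ℚ) := by
  have key := add_add_one_mul_sum_choose_mul_choose n i j
  constructor
  · rw [key, mul_comm (i + 1), Nat.choose_succ_right_eq, mul_comm (n.choose i)]
  · obtain ⟨m, rfl⟩ : ∃ m, n = m + 1 := ⟨n - 1, by omega⟩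
    rw [mul_comm (i + 1), ← Nat.add_one_mul_choose_eq] at key
    have keyQ := congrArg (Nat.cast : ℕ → ℚ) key
    have hpos : (i + j + 1 : ℚ) ≠ 0 := by positivity
    rw [Int.ringChoose_neg_sub_one, Nat.add_sub_cancel]
    push_cast at keyQ ⊢
    apply mul_left_cancel₀ hpos
    rw [keyQ]
    rcases neg_one_pow_eq_or ℚ j with h | h <;> rw [h] <;> field_simp
end

section
/- Let p be an odd prime and let m be an integer with gcd(m,p) = 1. Then, computing in ℤ/pℤ, 2 · Σ_{k=0}^{p-1} C_k·(m⁻¹)^k = (4-m)·(m(m-4)/p) + m − 2, where (·/p) is the Legendre symbol. -/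
theorem succ_succ_mul_catalan_succ (k : ℕ) :
    (k + 2) * catalan (k + 1) = 2 * (2 * k + 1) * catalan k := by
  have h := Nat.succ_mul_centralBinom_succ k
  rw [← succ_mul_catalan_eq_centralBinom, ← succ_mul_catalan_eq_centralBinom] at h
  apply Nat.eq_of_mul_eq_mul_left (Nat.succ_pos k)
  rw [Nat.succ_eq_add_one]
  linarith

theorem mul_catalan_eq_choose (k : ℕ) : k * catalan k = (2 * k).choose (k + 1) := by
  have h := Nat.choose_succ_right_eq (2 * k) k
  rw [← Nat.centralBinom_eq_two_mul_choose, ← succ_mul_catalan_eq_centralBinom,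
    show 2 * k - k = k by omega] at h
  apply Nat.eq_of_mul_eq_mul_left (Nat.succ_pos k)
  rw [Nat.succ_eq_add_one]
  linarith

theorem catalan_prime_sub_one (n : ℕ) [Fact (Nat.Prime (2 * n + 1))] :
    (catalan (2 * n) : ZMod (2 * n + 1)) = -1 := by
  have hn : 1 ≤ n := by
    by_contra h
    have := (Fact.out : Nat.Prime (2 * n + 1)).two_le
    omega
  have h := Choose.choose_modEq_choose_mod_mul_choose_div_nat
    (n := 2 * (2 * n)) (k := 2 * n + 1) (p := 2 * n + 1)
  have hd : 2 * (2 * n) / (2 * n + 1) = 1 := by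
    apply Nat.div_eq_of_lt_le <;> omega
  rw [hd, Nat.mod_self, Nat.div_self (by omega), ← mul_catalan_eq_choose,
    ← ZMod.natCast_eq_natCast_iff] at h
  have hp : ((2 * n + 1 : ℕ) : ZMod (2 * n + 1)) = 0 := ZMod.natCast_self _
  push_cast at h hp
  simp only [Nat.choose_self, Nat.choose_zero_right, Nat.cast_one, mul_one] at h
  linear_combination (catalan (2 * n) : ZMod (2 * n + 1)) * hp - h

theorem choose_mul_neg_four_pow (n : ℕ) [Fact (Nat.Prime (2 * n + 1))] (k : ℕ)
    (hk : k < 2 * n) :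
    ((n + 1).choose (k + 1) : ZMod (2 * n + 1)) * (-4) ^ (k + 1) = -2 * catalan k := by
  have hp : ((2 * n + 1 : ℕ) : ZMod (2 * n + 1)) = 0 := ZMod.natCast_self _
  push_cast at hp
  induction k with
  | zero =>
    simp only [zero_add, Nat.choose_one_right, catalan_zero]
    push_cast
    linear_combination (-2) * hp
  | succ k ih =>
    have ih := ih (by omega)
    have hne : ((k + 2 : ℕ) : ZMod (2 * n + 1)) ≠ 0 := by
      rw [Ne, ZMod.natCast_eq_zero_iff]
      intro h
      have := Nat.le_of_dvd (by omega) h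
      omega
    have hc := congrArg (Nat.cast : ℕ → ZMod (2 * n + 1)) (succ_succ_mul_catalan_succ k)
    have hb : ((n + 1).choose (k + 2) : ZMod (2 * n + 1)) * (k + 2)
        = (n + 1).choose (k + 1) * (n - k) := by
      have h := Nat.choose_succ_right_eq (n + 1) (k + 1)
      rcases le_or_gt k n with hkn | hkn
      · have h' := congrArg (Nat.cast : ℕ → ZMod (2 * n + 1)) h
        rw [show n + 1 - (k + 1) = n - k by omega] at h'
        push_cast [Nat.cast_sub hkn] at h'
        linear_combination h'
      · rw [Nat.choose_eq_zero_of_lt (show n + 1 < k + 2 by omega),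
          Nat.choose_eq_zero_of_lt (show n + 1 < k + 1 by omega)]
        simp
    apply mul_left_cancel₀ hne
    push_cast at hc ⊢
    linear_combination (-4) ^ (k + 2) * hb + (-4) * ((n : ZMod (2 * n + 1)) - k) * ih + 2 * hc
      + 4 * (catalan k : ZMod (2 * n + 1)) * hp

theorem one_sub_four_mul_pow_succ (n : ℕ) [Fact (Nat.Prime (2 * n + 1))]
    (x : ZMod (2 * n + 1)) :
    (1 - 4 * x) ^ (n + 1) = 1 - 2 * x * ∑ k ∈ Finset.range (2 * n), (catalan k : ZMod _) * x ^ k := by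
  have hn : 1 ≤ n := by
    by_contra h
    have := (Fact.out : Nat.Prime (2 * n + 1)).two_le
    omega
  have h : (1 - 4 * x) ^ (n + 1)
      = ∑ j ∈ Finset.range (2 * n + 1), (-4 * x) ^ j * ((n + 1).choose j : ZMod (2 * n + 1)) := by
    rw [show 1 - 4 * x = -4 * x + 1 by ring, add_pow]
    simp only [one_pow, mul_one]
    apply Finset.sum_subset
    · intro j
      simp only [Finset.mem_range]
      omega
    · intro j _ hj
      rw [Finset.mem_range, not_lt] at hj
      rw [Nat.choose_eq_zero_of_lt (by omega)]
      simp
  rw [h, Finset.sum_range_succ', Finset.mul_sum, sub_eq_add_neg, ← Finset.sum_neg_distrib,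
    add_comm (1 : ZMod (2 * n + 1))]
  congr 1
  · apply Finset.sum_congr rfl
    intro k hk
    rw [mul_pow]
    linear_combination x ^ (k + 1) * choose_mul_neg_four_pow n k (Finset.mem_range.mp hk)
  · simp

theorem stmt_11 (p : ℕ) [Fact (Nat.Prime p)] (hodd : Odd p)
    (m : ℤ) (hmp : Int.gcd m p = 1) :
    2 * ∑ k ∈ Finset.range p, (catalan k : ZMod p) * ((m : ZMod p)⁻¹) ^ k =
      (4 - (m : ZMod p)) * (legendreSym p (m * (m - 4)) : ZMod p) + (m : ZMod p) - 2 := by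
  obtain ⟨n, rfl⟩ := hodd
  have hm : (m : ZMod (2 * n + 1)) ≠ 0 := by
    rw [Ne, ZMod.intCast_zmod_eq_zero_iff_dvd]
    intro h
    rw [Int.gcd_eq_natAbs_right h, Int.natAbs_natCast] at hmp
    exact (Fact.out : Nat.Prime (2 * n + 1)).one_lt.ne' hmp
  rw [legendreSym.eq_pow, show (2 * n + 1) / 2 = n by omega, Finset.sum_range_succ,
    catalan_prime_sub_one]
  push_cast
  generalize (m : ZMod (2 * n + 1)) = μ at hm ⊢
  have hx : μ * μ⁻¹ = 1 := mul_inv_cancel₀ hm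
  have hpow : μ ^ (2 * n) = 1 := by simpa using ZMod.pow_card_sub_one_eq_one hm
  have hpow' : μ⁻¹ ^ (2 * n) = 1 := by simp [inv_pow, hpow]
  have hE : (μ * (μ - 4)) ^ n = (1 - 4 * μ⁻¹) ^ n := by
    rw [show μ * (μ - 4) = μ ^ 2 * (1 - 4 * μ⁻¹) by linear_combination 4 * μ * hx,
      mul_pow, ← pow_mul, hpow, one_mul]
  have h := one_sub_four_mul_pow_succ n μ⁻¹
  rw [pow_succ] at h
  rw [hE, hpow']
  set S := ∑ k ∈ Finset.range (2 * n), (catalan k : ZMod (2 * n + 1)) * μ⁻¹ ^ k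
  linear_combination μ * h - (2 * S - 4 * (1 - 4 * μ⁻¹) ^ n) * hx
end

section
/- Let p be an odd prime. Then Σ_{k=0}^{p-1} C(k,(p-1)/2)² ≡ (-1)^{(p-1)/2} (mod p). -/
/-- Summing a polynomial of degree at most `q - 1` over the field with `q` elements extracts
minus the coefficient of degree `q - 1`. -/
theorem FiniteField.sum_eval_eq_neg_coeff {K : Type*} [Field K] [Fintype K] (P : Polynomial K)
    (hP : P.natDegree < Fintype.card K) :
    ∑ x : K, P.eval x = -P.coeff (Fintype.card K - 1) := by
  classical
  have hq : 1 < Fintype.card K := Fintype.one_lt_card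
  have hlast : ∑ x : K, x ^ (Fintype.card K - 1) = -1 := by
    have h (x : K) : x ^ (Fintype.card K - 1) = 1 - if x = 0 then 1 else 0 := by
      split_ifs with hx
      · rw [hx, zero_pow (by omega), sub_self]
      · rw [FiniteField.pow_card_sub_one_eq_one x hx, sub_zero]
    simp [h, Finset.sum_sub_distrib]
  simp_rw [Polynomial.eval_eq_sum_range' hP]
  rw [Finset.sum_comm, Finset.sum_eq_single (Fintype.card K - 1)]
  · rw [← Finset.mul_sum, hlast, mul_neg_one]
  · intro i hi hne
    rw [Finset.mem_range] at hi
    rw [← Finset.mul_sum, FiniteField.sum_pow_lt_card_sub_one K i (by omega), mul_zero]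
  · intro h
    exact absurd (Finset.mem_range.2 (by omega)) h

/-- If `p = 2n + 1` is prime, then `(-1)ⁿ (n!)² = -1` modulo `p`. -/
theorem ZMod.neg_one_pow_mul_factorial_sq (n : ℕ) [Fact (2 * n + 1).Prime] :
    (-1 : ZMod (2 * n + 1)) ^ n * (n.factorial : ZMod (2 * n + 1)) ^ 2 = -1 := by
  have hdesc : ((2 * n).descFactorial n : ZMod (2 * n + 1)) = (-1) ^ n * n.factorial := by
    rw [Nat.descFactorial_eq_prod_range, ← Finset.prod_range_add_one_eq_factorial]
    push_cast
    have hpow : (-1 : ZMod (2 * n + 1)) ^ n = ∏ _i ∈ Finset.range n, (-1) := by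
      rw [Finset.prod_const, Finset.card_range]
    rw [hpow, ← Finset.prod_mul_distrib]
    refine Finset.prod_congr rfl fun i hi => ?_
    rw [Finset.mem_range] at hi
    rw [Nat.cast_sub (by omega)]
    have h := ZMod.natCast_self (2 * n + 1)
    push_cast at h ⊢
    linear_combination h
  have hw := ZMod.wilsons_lemma (2 * n + 1)
  rw [Nat.add_sub_cancel, ← Nat.factorial_mul_descFactorial (show n ≤ 2 * n by omega),
    show 2 * n - n = n by omega, Nat.cast_mul, hdesc] at hw
  linear_combination hw

theorem stmt_15 (p : ℕ) (hp : p.Prime) (hodd : Odd p) :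
    (∑ k ∈ Finset.range p, (k.choose ((p - 1) / 2) : ℤ) ^ 2) ≡
      (-1) ^ ((p - 1) / 2) [ZMOD p] := by
  obtain ⟨n, rfl⟩ := hodd
  have : Fact (2 * n + 1).Prime := ⟨hp⟩
  rw [show (2 * n + 1 - 1) / 2 = n by omega, ← ZMod.intCast_eq_intCast_iff]
  push_cast
  have hmonic := (monic_descPochhammer (ZMod (2 * n + 1)) n).pow 2
  have hdeg : ((descPochhammer (ZMod (2 * n + 1)) n) ^ 2).natDegree = 2 * n := by
    rw [(monic_descPochhammer _ n).natDegree_pow, descPochhammer_natDegree]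
  have hsum := FiniteField.sum_eval_eq_neg_coeff ((descPochhammer (ZMod (2 * n + 1)) n) ^ 2)
    (by rw [hdeg, ZMod.card]; omega)
  have hcoeff := hmonic.coeff_natDegree
  rw [hdeg] at hcoeff
  rw [ZMod.card, Nat.add_sub_cancel, hcoeff] at hsum
  have hrange : ∑ x : ZMod (2 * n + 1), ((descPochhammer (ZMod (2 * n + 1)) n) ^ 2).eval x =
      (n.factorial : ZMod (2 * n + 1)) ^ 2 *
        ∑ k ∈ Finset.range (2 * n + 1), (k.choose n : ZMod (2 * n + 1)) ^ 2 := by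
    rw [Finset.mul_sum]
    symm
    refine Finset.sum_bij (fun k _ => (k : ZMod (2 * n + 1))) (fun _ _ => Finset.mem_univ _)
      ?_ ?_ ?_
    · intro a ha b hb h
      rw [Finset.mem_range] at ha hb
      exact Nat.ModEq.eq_of_lt_of_lt ((ZMod.natCast_eq_natCast_iff _ _ _).1 h) ha hb
    · intro x _
      exact ⟨x.val, Finset.mem_range.2 x.val_lt, ZMod.natCast_zmod_val x⟩
    · intro k _
      rw [Polynomial.eval_pow, descPochhammer_eval_eq_descFactorial,
        Nat.descFactorial_eq_factorial_mul_choose, Nat.cast_mul, mul_pow]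
  rw [hrange] at hsum
  have hw := ZMod.neg_one_pow_mul_factorial_sq n
  linear_combination (-(-1) ^ n) * hsum +
    (∑ k ∈ Finset.range (2 * n + 1), (k.choose n : ZMod (2 * n + 1)) ^ 2) * hw
end
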